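/- Asymptotic expansion: for every integer d ≥ 2 there exist constants K > 0 and N such that for all n ≥ N, | C(n,d) · ∫₀^π (1 − α/π)^{n−d} sin^{d−1}(α) dα − (π^d/d)·(1 − C(d+1,3)·π²·n^{−2}) | ≤ K·n^{−3}, where C(n,d) and C(d+1,3) denote binomial coefficients. In other words, C(n,d) ∫₀^π (1 − α/π)^{n−d} sin^{d−1}α dα = (π^d/d)[1 − C(d+1,3)π² n^{−2} + O(n^{−3})] as n → ∞. -/

import Mathlib

open MeasureTheory Real Filter Set
open scoped ENNReal NNReal BigOperators RealInnerProductSpace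

noncomputable section

/-- `ℝ^{d+1}`. -/
abbrev Euc (d : ℕ) : Type := EuclideanSpace ℝ (Fin (d + 1))

/-- The unit sphere `S^d ⊆ ℝ^{d+1}`. -/
def Sph (d : ℕ) : Set (Euc d) := Metric.sphere (0 : Euc d) 1

/-- `ω_k = 2 π^{k/2} / Γ(k/2)`, the total spherical Lebesgue measure of `S^{k-1}`. -/
def omegaS (k : ℝ) : ℝ := 2 * Real.pi ^ (k / 2) / Real.Gamma (k / 2)

/-- The spherical Lebesgue measure `σ` on `S^d`: the `d`-dimensional Hausdorff
measure restricted to the sphere. -/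
def sphLeb (d : ℕ) : Measure (Euc d) := (μH[(d : ℝ)]).restrict (Sph d)

/-- The closed halfsphere `S⁺_e`. -/
def hemi (d : ℕ) (e : Euc d) : Set (Euc d) := {u ∈ Sph d | 0 ≤ ⟪u, e⟫}

/-- The uniform probability distribution `μ = (2/ω_{d+1}) σ|_{S⁺_e}` on the halfsphere. -/
def unifHemi (d : ℕ) (e : Euc d) : Measure (Euc d) :=
  (ENNReal.ofReal (2 / omegaS (d + 1))) • (μH[(d : ℝ)]).restrict (hemi d e)

/-- The positive (conical) hull of a set `A ⊆ ℝ^{d+1}`. -/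
def posHull (d : ℕ) (A : Set (Euc d)) : Set (Euc d) :=
  {x | ∃ (k : ℕ) (c : Fin k → ℝ) (v : Fin k → Euc d),
      (∀ i, 0 ≤ c i) ∧ (∀ i, v i ∈ A) ∧ x = ∑ i, c i • v i}

/-- The spherical convex hull `conv_s A = S^d ∩ pos A`. -/
def sconv (d : ℕ) (A : Set (Euc d)) : Set (Euc d) := Sph d ∩ posHull d A

/-- The spherical (geodesic) distance `d_s(x,y) = arccos ⟨x,y⟩`. -/
def dsph (d : ℕ) (x y : Euc d) : ℝ := Real.arccos ⟪x, y⟫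

/-- The spherical Hausdorff distance of two subsets of `S^d`. -/
def sHausdorff (d : ℕ) (K M : Set (Euc d)) : ℝ :=
  max (⨆ x ∈ K, ⨅ y ∈ M, dsph d x y) (⨆ x ∈ M, ⨅ y ∈ K, dsph d x y)

/-- `F` is a face of dimension `k` of the spherical polytope `P`:
`F` is the intersection of `P` with a supporting great subsphere, and the linear
span of `F` has dimension `k + 1`. -/
def IsFaceOfDim (d : ℕ) (P : Set (Euc d)) (k : ℕ) (F : Set (Euc d)) : Prop :=
  (∃ v : Euc d, v ≠ 0 ∧ (∀ x ∈ P, 0 ≤ ⟪x, v⟫) ∧ F = P ∩ {x | ⟪x, v⟫ = 0}) ∧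
    Module.finrank ℝ (Submodule.span ℝ F) = k + 1

/-- `f_k(P)`, the number of `k`-dimensional faces of a spherical polytope `P`. -/
def faceCount (d : ℕ) (k : ℕ) (P : Set (Euc d)) : ℕ :=
  Nat.card {F : Set (Euc d) // IsFaceOfDim d P k F}

/-- The spherical surface area of `P ⊆ S^d`: the `(d-1)`-dimensional Hausdorff
measure of the boundary of `P` relative to `S^d`. -/
def sArea (d : ℕ) (P : Set (Euc d)) : ℝ :=
  (μH[(d : ℝ) - 1] (closure P ∩ closure (Sph d \ P))).toReal

/-- The spherical mean width
`U₁(K) = (1/(2 ω_{d+1})) ∫_{S^d} 1{K ∩ v^⊥ ≠ ∅} σ(dv)`. -/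
def meanWidth (d : ℕ) (K : Set (Euc d)) : ℝ :=
  (1 / (2 * omegaS (d + 1))) *
    ∫ v in Sph d,
      Set.indicator {v : Euc d | (K ∩ {x | ⟪x, v⟫ = 0}).Nonempty} (fun _ => (1 : ℝ)) v
      ∂μH[(d : ℝ)]

/-- `∇_d(u₁,…,u_d)`: the `d`-dimensional volume of the parallelepiped spanned by
`u₁,…,u_d ∈ ℝ^{d+1}`, i.e. the square root of the Gram determinant. -/
def gramVol (d : ℕ) (u : Fin d → Euc d) : ℝ :=
  Real.sqrt (Matrix.det (Matrix.of fun i j => ⟪u i, u j⟫))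

/-- The great subsphere `e^⊥ ∩ S^d`. -/
def equator (d : ℕ) (e : Euc d) : Set (Euc d) := {x ∈ Sph d | ⟪x, e⟫ = 0}

/-- The constant `C(d)` (defined via a pair of orthogonal unit vectors `e ⊥ ē`):
`C(d) = ∫_{(e^⊥ ∩ S⁺_ē)^d} ∇_d(u₁,…,u_d) ∫_{conv_s{u₁,…,u_d}} ⟨x,ē⟩ σ_{d-1}(dx)
  σ_{d-1}^d(d(u₁,…,u_d))`. -/
def Cconst (d : ℕ) (e ebar : Euc d) : ℝ :=
  ∫ u : Fin d → Euc d,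
      gramVol d u * ∫ x in sconv d (Set.range u), ⟪x, ebar⟫ ∂μH[(d : ℝ) - 1]
    ∂(Measure.pi fun _ : Fin d =>
        (μH[(d : ℝ) - 1]).restrict {x ∈ equator d e | 0 ≤ ⟪x, ebar⟫})

/-- A spherically convex set: the intersection of `S^d` with a closed convex cone. -/
def SphConvex (d : ℕ) (K : Set (Euc d)) : Prop :=
  ∃ C : Set (Euc d), IsClosed C ∧ Convex ℝ C ∧
    (∀ a : ℝ, 0 ≤ a → ∀ x ∈ C, a • x ∈ C) ∧ K = Sph d ∩ C

/-- The interior of `A` relative to the sphere `S^d`. -/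
def sInterior (d : ℕ) (A : Set (Euc d)) : Set (Euc d) :=
  {x ∈ Sph d | ∃ U : Set (Euc d), IsOpen U ∧ x ∈ U ∧ U ∩ Sph d ⊆ A}

/-- The closed spherical ball `B(x, ε)` in `S⁺_e`. -/
def sBall (d : ℕ) (e : Euc d) (x : Euc d) (ε : ℝ) : Set (Euc d) :=
  {y ∈ hemi d e | dsph d x y ≤ ε}

lemma hasDerivAt_pow_mul_one_sub_div_pow {c : ℝ} (a m : ℕ) (x : ℝ) :
    HasDerivAt (fun x : ℝ => x ^ (a + 1) * (1 - x / c) ^ (m + 1))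
      ((a + 1) * ((1 - x / c) ^ (m + 1) * x ^ a) -
        (m + 1) / c * ((1 - x / c) ^ m * x ^ (a + 1))) x := by
  have h := (hasDerivAt_pow (a + 1) x).mul
    ((((hasDerivAt_id x).div_const c).const_sub 1).pow (m + 1))
  refine h.congr_deriv ?_
  simp
  ring

lemma integral_one_sub_div_pow_succ_mul_pow {c : ℝ} (hc : c ≠ 0) (a m : ℕ) :
    (a + 1) * ∫ x in (0 : ℝ)..c, (1 - x / c) ^ (m + 1) * x ^ a =
      (m + 1) / c * ∫ x in (0 : ℝ)..c, (1 - x / c) ^ m * x ^ (a + 1) := by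
  have hinteg (p q : ℕ) (r : ℝ) : IntervalIntegrable
      (fun x : ℝ => r * ((1 - x / c) ^ p * x ^ q)) volume 0 c :=
    Continuous.intervalIntegrable (by fun_prop) _ _
  have h := intervalIntegral.integral_eq_sub_of_hasDerivAt
    (fun x _ => hasDerivAt_pow_mul_one_sub_div_pow (c := c) a m x)
    ((hinteg (m + 1) a (a + 1)).sub (hinteg m (a + 1) ((m + 1) / c)))
  rw [intervalIntegral.integral_sub (hinteg _ _ _) (hinteg _ _ _),
    intervalIntegral.integral_const_mul, intervalIntegral.integral_const_mul] at h
  simp [hc] at h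
  linarith

/-- The Euler beta integral with natural number exponents, scaled to `[0, c]`. -/
lemma integral_one_sub_div_pow_mul_pow {c : ℝ} (hc : c ≠ 0) (a m : ℕ) :
    (∫ x in (0 : ℝ)..c, (1 - x / c) ^ m * x ^ a) * (a + m + 1).factorial =
      c ^ (a + 1) * a.factorial * m.factorial := by
  induction m generalizing a with
  | zero =>
    simp [integral_pow, Nat.factorial_succ]
    field_simp
  | succ m ih =>
    have h := integral_one_sub_div_pow_succ_mul_pow hc a m
    have h' := ih (a + 1)
    rw [show a + 1 + m + 1 = a + (m + 1) + 1 by ring, Nat.factorial_succ a] at h'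
    rw [Nat.factorial_succ m]
    have ha : (a + 1 : ℝ) ≠ 0 := by positivity
    refine mul_left_cancel₀ ha ?_
    rw [← mul_assoc, h, mul_assoc, h']
    push_cast
    field_simp
    ring

lemma abs_sin_sub_cubic_le {x : ℝ} (hx : 0 ≤ x) : |Real.sin x - (x - x ^ 3 / 6)| ≤ 3 * x ^ 5 := by
  rcases le_total x 1 with h | h
  · have hb := Real.sin_bound (x := x) (by rwa [abs_of_nonneg hx])
    rw [abs_of_nonneg hx] at hb
    have := pow_nonneg hx 5
    linarith
  · have h1 := abs_le.1 (Real.abs_sin_le_one x)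
    have h2 : x ^ 3 ≤ x ^ 5 := pow_le_pow_right₀ h (by norm_num)
    have h3 : x ≤ x ^ 5 := le_self_pow₀ h (by norm_num)
    have h4 : 0 ≤ x ^ 3 := by positivity
    rw [abs_le]
    constructor <;> linarith

/-- Second order expansion at zero of a power of the sine, uniformly on `[0, π]`. -/
lemma exists_abs_sin_pow_sub_le (k : ℕ) : ∃ C : ℝ, 0 ≤ C ∧ ∀ x ∈ Icc 0 π,
    |Real.sin x ^ k - (x ^ k - k / 6 * x ^ (k + 2))| ≤ C * x ^ (k + 4) := by
  induction k with
  | zero => exact ⟨0, le_rfl, fun x _ => by simp⟩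
  | succ k ih =>
    obtain ⟨C, hC, h⟩ := ih
    refine ⟨C + 3 * (1 + k / 6 * 16) + k / 36, by positivity, fun x hx => ?_⟩
    have hx0 : 0 ≤ x := hx.1
    have hx2 : x ^ 2 ≤ 16 := by nlinarith [hx.2, Real.pi_le_four]
    have hs : |Real.sin x| ≤ x := by
      rw [abs_of_nonneg (Real.sin_nonneg_of_mem_Icc hx)]
      exact Real.sin_le hx0
    have hq : |1 - (k : ℝ) / 6 * x ^ 2| ≤ 1 + (k : ℝ) / 6 * 16 := by
      have : (k / 6 : ℝ) * x ^ 2 ≤ k / 6 * 16 := by gcongr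
      have : 0 ≤ (k / 6 : ℝ) * x ^ 2 := by positivity
      rw [abs_le]
      constructor <;> linarith
    have key : Real.sin x ^ (k + 1) - (x ^ (k + 1) - (k + 1 : ℕ) / 6 * x ^ (k + 1 + 2)) =
        Real.sin x * (Real.sin x ^ k - (x ^ k - k / 6 * x ^ (k + 2))) +
        (Real.sin x - (x - x ^ 3 / 6)) * (1 - k / 6 * x ^ 2) * x ^ k +
        k / 36 * x ^ (k + 5) := by
      push_cast
      ring
    rw [key]
    have hxk : |x ^ k| = x ^ k := abs_of_nonneg (by positivity)
    have hxk' : |(k / 36 : ℝ) * x ^ (k + 5)| = k / 36 * x ^ (k + 5) :=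
      abs_of_nonneg (by positivity)
    calc _ ≤ |Real.sin x| * |Real.sin x ^ k - (x ^ k - (k : ℝ) / 6 * x ^ (k + 2))| +
          |Real.sin x - (x - x ^ 3 / 6)| * |1 - (k : ℝ) / 6 * x ^ 2| * x ^ k +
          k / 36 * x ^ (k + 5) := by
          refine (abs_add_three _ _ _).trans_eq ?_
          rw [abs_mul, abs_mul, abs_mul, hxk, hxk']
      _ ≤ x * (C * x ^ (k + 4)) + 3 * x ^ 5 * (1 + k / 6 * 16) * x ^ k +
          k / 36 * x ^ (k + 5) := by
          gcongr
          · exact h x hx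
          · exact abs_sin_sub_cubic_le hx0
      _ = _ := by ring

/-- A pointwise bound `|f - (x ^ k - b x ^ (k + 2))| ≤ C x ^ (k + 4)` integrates against the
weight `(1 - x / c) ^ m`. -/
lemma abs_integral_sub_le {f : ℝ → ℝ} (hf : Continuous f) {c b C : ℝ} (hc : 0 < c) {k : ℕ}
    (h : ∀ x ∈ Icc 0 c, |f x - (x ^ k - b * x ^ (k + 2))| ≤ C * x ^ (k + 4)) (m : ℕ) :
    |(∫ x in (0 : ℝ)..c, (1 - x / c) ^ m * f x) -
      ((∫ x in (0 : ℝ)..c, (1 - x / c) ^ m * x ^ k) -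
        b * ∫ x in (0 : ℝ)..c, (1 - x / c) ^ m * x ^ (k + 2))| ≤
      C * ∫ x in (0 : ℝ)..c, (1 - x / c) ^ m * x ^ (k + 4) := by
  have hinteg {g : ℝ → ℝ} (hg : Continuous g) : IntervalIntegrable g volume 0 c :=
    hg.intervalIntegrable _ _
  rw [← intervalIntegral.integral_const_mul, ← intervalIntegral.integral_const_mul,
    ← intervalIntegral.integral_sub, ← intervalIntegral.integral_sub]
  any_goals exact hinteg (by fun_prop)
  rw [← Real.norm_eq_abs]
  refine intervalIntegral.norm_integral_le_of_norm_le hc.le (ae_of_all _ fun x hx => ?_)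
    (hinteg ?_)
  swap
  · fun_prop
  have hw : 0 ≤ (1 - x / c) ^ m := pow_nonneg (sub_nonneg.2 ((div_le_one hc).2 hx.2)) m
  rw [Real.norm_eq_abs, show (1 - x / c) ^ m * f x -
      ((1 - x / c) ^ m * x ^ k - b * ((1 - x / c) ^ m * x ^ (k + 2))) =
      (1 - x / c) ^ m * (f x - (x ^ k - b * x ^ (k + 2))) by ring, abs_mul, abs_of_nonneg hw,
    mul_left_comm]
  exact mul_le_mul_of_nonneg_left (h x (Ioc_subset_Icc_self hx)) hw

lemma choose_mul_integral_one_sub_div_pow_mul_pow {c : ℝ} (hc : c ≠ 0) (k m a : ℕ) :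
    ((m + (k + 1)).choose (k + 1) : ℝ) * (∫ x in (0 : ℝ)..c, (1 - x / c) ^ m * x ^ (k + a)) *
      ((k + 1) * (m + (k + 1) + 1).ascFactorial a) =
      c ^ (k + 1 + a) * (k + 1).ascFactorial a := by
  have h := integral_one_sub_div_pow_mul_pow hc (k + a) m
  have h1 : ((m + (k + 1)).factorial : ℝ) * (m + (k + 1) + 1).ascFactorial a =
      (k + a + m + 1).factorial := by
    rw [show k + a + m + 1 = m + (k + 1) + a by ring]
    exact_mod_cast Nat.factorial_mul_ascFactorial _ _
  have h2 : (k.factorial : ℝ) * (k + 1).ascFactorial a = (k + a).factorial :=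
    mod_cast Nat.factorial_mul_ascFactorial _ _
  have h3 : ((m + (k + 1)).choose (k + 1) : ℝ) * m.factorial * ((k + 1) * k.factorial) =
      (m + (k + 1)).factorial := by
    exact_mod_cast Nat.add_choose_mul_factorial_mul_factorial m (k + 1)
  rw [← h1, ← h2, ← h3] at h
  have hm : (m.factorial : ℝ) ≠ 0 := by positivity
  have hk : (k.factorial : ℝ) ≠ 0 := by positivity
  refine mul_right_cancel₀ (mul_ne_zero hm hk) ?_
  rw [show k + 1 + a = k + a + 1 by ring]
  linear_combination h

lemma abs_one_div_sub_one_div_sq_le {x : ℝ} (hx : 0 < x) :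
    |1 / ((x + 1) * (x + 2)) - 1 / x ^ 2| ≤ 3 / x ^ 3 := by
  have h : 1 / ((x + 1) * (x + 2)) - 1 / x ^ 2 = -((3 * x + 2) / ((x + 1) * (x + 2) * x ^ 2)) := by
    field_simp
    ring
  rw [h, abs_neg, abs_of_nonneg (by positivity), div_le_div_iff₀ (by positivity) (by positivity)]
  have : 0 ≤ x ^ 2 * (7 * x + 6) := by positivity
  nlinarith

/-- **Asymptotic expansion.** For every `d ≥ 2`,
`(n choose d) ∫₀^π (1-α/π)^{n-d} sin^{d-1} α dα
  = (π^d/d) [1 - C(d+1,3) π² n^{-2} + O(n^{-3})]` as `n → ∞`. -/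
theorem asymptotic_expansion (d : ℕ) (hd : 2 ≤ d) :
    ∃ K > (0 : ℝ), ∃ N : ℕ, ∀ n : ℕ, N ≤ n →
      |(n.choose d : ℝ) *
          (∫ α in (0 : ℝ)..π, (1 - α / π) ^ (n - d) * Real.sin α ^ (d - 1)) -
        (π ^ d / d) * (1 - ((d + 1).choose 3 : ℝ) * π ^ 2 / (n : ℝ) ^ 2)| ≤
      K / (n : ℝ) ^ 3 := by
  obtain ⟨k, rfl⟩ : ∃ k, d = k + 1 := ⟨d - 1, by omega⟩
  obtain ⟨C, hC, hsin⟩ := exists_abs_sin_pow_sub_le k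
  set A : ℝ := k / 6 * π ^ (k + 3) * (k + 2) with hA
  set B : ℝ := C * π ^ (k + 5) * ((k + 2) * (k + 3) * (k + 4)) with hB
  refine ⟨B + 3 * A + 1, by positivity, k + 1, fun n hn => ?_⟩
  obtain ⟨m, rfl⟩ := Nat.exists_eq_add_of_le' hn
  rw [Nat.add_sub_cancel, Nat.add_sub_cancel]
  have hI := abs_integral_sub_le (Real.continuous_sin.pow k) Real.pi_pos hsin m
  have hmom := choose_mul_integral_one_sub_div_pow_mul_pow Real.pi_ne_zero k m
  have h0 := hmom 0
  have h2 := hmom 2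
  have h4 := hmom 4
  have hchoose : (((k + 1 + 1).choose 3 : ℕ) : ℝ) = (k + 2) * (k + 1) * k / 6 := by
    rw [Nat.cast_choose_eq_ascPochhammer_div]
    simp [ascPochhammer_succ_right, Nat.factorial]
    ring
  rw [hchoose]
  have hx1 : (1 : ℝ) ≤ (m + (k + 1) : ℕ) := by exact_mod_cast (by omega : 1 ≤ m + (k + 1))
  have hcp : (0 : ℝ) ≤ ((m + (k + 1)).choose (k + 1) : ℕ) := by positivity
  generalize m + (k + 1) = n at h0 h2 h4 hx1 hcp ⊢
  simp only [Nat.ascFactorial, add_zero] at h0 h2 h4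
  push_cast at h0 h2 h4
  generalize (n : ℝ) = x at *
  generalize ((n.choose (k + 1) : ℕ) : ℝ) = c at *
  generalize (∫ α in (0 : ℝ)..π, (1 - α / π) ^ m * Real.sin α ^ k) = I at *
  generalize (∫ α in (0 : ℝ)..π, (1 - α / π) ^ m * α ^ k) = I0 at *
  generalize (∫ α in (0 : ℝ)..π, (1 - α / π) ^ m * α ^ (k + 2)) = I2 at *
  generalize (∫ α in (0 : ℝ)..π, (1 - α / π) ^ m * α ^ (k + 4)) = I4 at *
  have hx : 0 < x := by linarith
  have e0 : c * I0 = π ^ (k + 1) / (k + 1) := by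
    rw [eq_div_iff (by positivity)]
    linear_combination h0
  have e2 : k / 6 * (c * I2) = A * (1 / ((x + 1) * (x + 2))) := by
    have hk : (k + 1 : ℝ) ≠ 0 := by positivity
    rw [mul_one_div, eq_div_iff (by positivity), hA]
    refine mul_left_cancel₀ hk ?_
    linear_combination k / 6 * h2
  have e4 : C * (c * I4) ≤ B / x ^ 3 := by
    have hk : (k + 1 : ℝ) ≠ 0 := by positivity
    have : C * (c * I4) = B / ((x + 1) * (x + 2) * (x + 3) * (x + 4)) := by
      rw [eq_div_iff (by positivity), hB]
      refine mul_left_cancel₀ hk ?_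
      linear_combination C * h4
    rw [this]
    have hB0 : 0 ≤ B := by positivity
    refine div_le_div_of_nonneg_left hB0 (by positivity) ?_
    calc x ^ 3 = x * x * x * 1 := by ring
      _ ≤ _ := by gcongr <;> linarith
  have hI' : |c * I - (π ^ (k + 1) / (k + 1) - A * (1 / ((x + 1) * (x + 2))))| ≤ B / x ^ 3 := by
    rw [← e0, ← e2, show c * I - (c * I0 - k / 6 * (c * I2)) = c * (I - (I0 - k / 6 * I2)) by ring,
      abs_mul, abs_of_nonneg hcp]
    refine le_trans ?_ e4
    rw [mul_left_comm]
    exact mul_le_mul_of_nonneg_left hI hcp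
  have hrat : |A * (1 / ((x + 1) * (x + 2)) - 1 / x ^ 2)| ≤ A * (3 / x ^ 3) := by
    have hA0 : 0 ≤ A := by positivity
    rw [abs_mul, abs_of_nonneg hA0]
    exact mul_le_mul_of_nonneg_left (abs_one_div_sub_one_div_sq_le hx) hA0
  have hsplit : c * I - π ^ (k + 1) / (k + 1 : ℕ) *
      (1 - (k + 2) * (k + 1) * k / 6 * π ^ 2 / x ^ 2) =
      (c * I - (π ^ (k + 1) / (k + 1) - A * (1 / ((x + 1) * (x + 2))))) -
        A * (1 / ((x + 1) * (x + 2)) - 1 / x ^ 2) := by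
    rw [hA]
    push_cast
    field_simp
    ring
  rw [hsplit]
  calc _ ≤ B / x ^ 3 + A * (3 / x ^ 3) := (abs_sub _ _).trans (add_le_add hI' hrat)
    _ ≤ (B + 3 * A + 1) / x ^ 3 := by
      rw [show B / x ^ 3 + A * (3 / x ^ 3) = (B + 3 * A) / x ^ 3 by ring]
      exact div_le_div_of_nonneg_right (by linarith) (by positivity)
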